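/- Let (X, μ) be a probability space, T : X → X a μ-preserving transformation, and φ : X → ℝ an integrable mean-zero observable satisfying a large deviation principle with rate function I defined on the open neighborhood U of 0. Fix α > 0 with α ∈ U and set ℓ_n := ⌊(log n)/I(α)⌋. Suppose in addition that there are a constant C > 0 and an integer τ ≥ 0 such that for every interval A ⊆ ℝ and every n, μ(⋂_{m=0}^{n−ℓ_n} {S_{ℓ_n}(φ)∘T^m ∈ A}) ≤ C·[μ(S_{ℓ_n}(φ) ∈ A)]^{n/(ℓ_n)^τ}. Then the lower Erdős–Rényi law holds: for μ-almost every x ∈ X, liminf_{n→∞} max_{0 ≤ j ≤ n−ℓ_n} (1/ℓ_n) S_{ℓ_n}(φ)(T^j x) ≥ α. -/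

import Mathlib

open MeasureTheory Filter Set

/-- The `n`-th Birkhoff sum `S_n(φ) = φ + φ∘T + … + φ∘T^{n−1}`. -/
noncomputable def birkhoff {X : Type*} (T : X → X) (φ : X → ℝ) (n : ℕ) (x : X) : ℝ :=
  ∑ i ∈ Finset.range n, φ (T^[i] x)

theorem StrictConvexOn.lt_of_pos_of_lt {U : Set ℝ} {I : ℝ → ℝ} (hI : StrictConvexOn ℝ U I)
    (hU0 : (0 : ℝ) ∈ U) (hI0 : I 0 = 0) (hInonneg : ∀ a ∈ U, 0 ≤ I a) {a b : ℝ}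
    (ha : 0 < a) (hab : a < b) (hb : b ∈ U) : I a < I b := by
  have hb0 : 0 < b := ha.trans hab
  have ht1 : a / b < 1 := (div_lt_one hb0).2 hab
  have h := hI.2 hU0 hb hb0.ne (sub_pos.2 ht1) (div_pos ha hb0) (by ring)
  simp only [smul_eq_mul, mul_zero, zero_add, hI0, div_mul_cancel₀ a hb0.ne'] at h
  nlinarith [hInonneg b hb]

theorem aemeasurable_birkhoff {X : Type*} [MeasurableSpace X] {μ : Measure X} {T : X → X}
    (hT : MeasurePreserving T μ μ) {φ : X → ℝ} (hφ : AEMeasurable φ μ) (n : ℕ) :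
    AEMeasurable (birkhoff T φ n) μ := by
  unfold birkhoff
  exact Finset.aemeasurable_fun_sum _ fun i _ =>
    hφ.comp_quasiMeasurePreserving (hT.iterate i).quasiMeasurePreserving

theorem ae_eventually_notMem_of_toReal_le {X : Type*} [MeasurableSpace X] {μ : Measure X}
    [IsFiniteMeasure μ] {s : ℕ → Set X} {g : ℕ → ℝ} (hg : Summable g)
    (h : ∀ᶠ n in atTop, (μ (s n)).toReal ≤ g n) : ∀ᵐ x ∂μ, ∀ᶠ n in atTop, x ∉ s n := by
  have hs : Summable fun n => (μ (s n)).toReal := by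
    refine Summable.of_norm_bounded_eventually_nat hg ?_
    filter_upwards [h] with n hn
    rwa [Real.norm_of_nonneg ENNReal.toReal_nonneg]
  refine ae_eventually_notMem ?_
  rw [← tsum_congr fun n => ENNReal.ofReal_toReal (measure_ne_top μ (s n)),
    ← ENNReal.ofReal_tsum_of_nonneg (fun _ => ENNReal.toReal_nonneg) hs]
  exact ENNReal.ofReal_ne_top

/-- Exponential lower bounds from a logarithmic asymptotic; the limit being negative excludes the
junk value `Real.log 0 = 0`. -/
theorem eventually_exp_neg_mul_le {p : ℕ → ℝ} (hp : ∀ n, 0 ≤ p n) {b b' : ℝ} (hb : 0 < b)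
    (hbb' : b < b') (h : Tendsto (fun n : ℕ => Real.log (p n) / n) atTop (nhds (-b))) :
    ∀ᶠ n : ℕ in atTop, Real.exp (-(b' * n)) ≤ p n := by
  filter_upwards [h.eventually (lt_mem_nhds (neg_lt_neg hbb')),
    h.eventually (gt_mem_nhds (neg_lt_zero.2 hb)), eventually_gt_atTop 0] with n h1 h2 hn
  have hn' : (0 : ℝ) < n := by exact_mod_cast hn
  have hpos : 0 < p n := by
    rcases (hp n).eq_or_lt with h0 | h0
    · simp [← h0] at h2
    · exact h0
  rw [lt_div_iff₀ hn'] at h1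
  rw [← Real.le_log_iff_exp_le hpos]
  linarith

theorem eventually_le_exp_neg_mul {p : ℕ → ℝ} (hp : ∀ n, 0 ≤ p n) {b b' : ℝ}
    (hbb' : b' < b) (h : Tendsto (fun n : ℕ => Real.log (p n) / n) atTop (nhds (-b))) :
    ∀ᶠ n : ℕ in atTop, p n ≤ Real.exp (-(b' * n)) := by
  filter_upwards [h.eventually (gt_mem_nhds (neg_lt_neg hbb')), eventually_gt_atTop 0]
    with n h1 hn
  have hn' : (0 : ℝ) < n := by exact_mod_cast hn
  rcases (hp n).eq_or_lt with h0 | h0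
  · rw [← h0]; exact (Real.exp_pos _).le
  · rw [div_lt_iff₀ hn'] at h1
    rw [← Real.log_le_iff_le_exp h0]
    linarith

theorem tendsto_floor_log_div_atTop {c : ℝ} (hc : 0 < c) :
    Tendsto (fun n : ℕ => ⌊Real.log n / c⌋₊) atTop atTop :=
  tendsto_nat_floor_atTop.comp
    ((Real.tendsto_log_atTop.comp tendsto_natCast_atTop_atTop).atTop_div_const hc)

theorem floor_log_div_mul_le {c : ℝ} (hc : 0 < c) {n : ℕ} (hn : 1 ≤ n) :
    c * (⌊Real.log n / c⌋₊ : ℝ) ≤ Real.log n := by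
  have := Nat.floor_le (div_nonneg (Real.log_nonneg (by exact_mod_cast hn : (1 : ℝ) ≤ n)) hc.le)
  rw [le_div_iff₀ hc] at this
  linarith

theorem log_lt_mul_floor_log_div_add_one {c : ℝ} (hc : 0 < c) (n : ℕ) :
    Real.log n < c * ((⌊Real.log n / c⌋₊ : ℝ) + 1) := by
  have := Nat.lt_floor_add_one (Real.log n / c)
  rw [div_lt_iff₀ hc] at this
  linarith

theorem eventually_mul_le_exp_mul_div_pow {δ : ℝ} (hδ : 0 < δ) (K : ℝ) (τ : ℕ) :
    ∀ᶠ m : ℕ in atTop, K * m ≤ Real.exp (δ * m) / (m : ℝ) ^ τ := by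
  have h := (tendsto_exp_mul_div_rpow_atTop ((τ + 1 : ℕ) : ℝ) δ hδ).comp
    tendsto_natCast_atTop_atTop
  filter_upwards [h.eventually_ge_atTop K, eventually_gt_atTop 0] with m hm hm0
  have hm' : (0 : ℝ) < m := by exact_mod_cast hm0
  simp only [Function.comp, Real.rpow_natCast] at hm
  rw [le_div_iff₀ (by positivity)] at hm ⊢
  calc K * m * (m : ℝ) ^ τ = K * (m : ℝ) ^ (τ + 1) := by ring
    _ ≤ _ := hm

/-- If the tails at level `a` decay at a rate `b < c`, then almost surely some window of length
`⌊log n / c⌋` eventually has average at least `a`. -/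
theorem ae_eventually_exists_le_birkhoff {X : Type*} [MeasurableSpace X] {μ : Measure X}
    [IsProbabilityMeasure μ] {T : X → X} (hT : MeasurePreserving T μ μ) {φ : X → ℝ}
    (hφ : AEMeasurable φ μ) {a b c : ℝ} (hb : 0 < b) (hbc : b < c)
    (hLDP : Tendsto (fun n : ℕ =>
        Real.log ((μ {x | (n : ℝ) * a ≤ birkhoff T φ n x}).toReal) / (n : ℝ))
      atTop (nhds (-b)))
    {C : ℝ} (hC : 0 < C) (τ : ℕ)
    (hblock : ∀ A : Set ℝ, A.OrdConnected → ∀ n : ℕ,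
      (μ (⋂ m ∈ Finset.range (n - ⌊Real.log n / c⌋₊ + 1),
          {x | birkhoff T φ ⌊Real.log n / c⌋₊ (T^[m] x) ∈ A})).toReal ≤
        C * ((μ {x | birkhoff T φ ⌊Real.log n / c⌋₊ x ∈ A}).toReal) ^
          ((n : ℝ) / (⌊Real.log n / c⌋₊ : ℝ) ^ τ)) :
    ∀ᵐ x ∂μ, ∀ᶠ n : ℕ in atTop, ∃ m ∈ Finset.range (n - ⌊Real.log n / c⌋₊ + 1),
      (⌊Real.log n / c⌋₊ : ℝ) * a ≤ birkhoff T φ ⌊Real.log n / c⌋₊ (T^[m] x) := by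
  have hc : 0 < c := hb.trans hbc
  obtain ⟨b', hbb', hb'c⟩ := exists_between hbc
  have hsum : Summable fun n : ℕ => C * (1 / (n : ℝ) ^ 2) :=
    (Real.summable_one_div_nat_pow.2 one_lt_two).mul_left C
  have hfl := tendsto_floor_log_div_atTop hc
  have key := ae_eventually_notMem_of_toReal_le (μ := μ)
    (s := fun n : ℕ => ⋂ m ∈ Finset.range (n - ⌊Real.log n / c⌋₊ + 1),
      {x | birkhoff T φ ⌊Real.log n / c⌋₊ (T^[m] x) ∈ Iio ((⌊Real.log n / c⌋₊ : ℝ) * a)})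
    hsum (by
      filter_upwards [hfl.eventually (eventually_exp_neg_mul_le
          (fun _ => ENNReal.toReal_nonneg) hb hbb' hLDP),
        hfl.eventually (eventually_mul_le_exp_mul_div_pow (sub_pos.2 hb'c) (4 * c) τ),
        hfl.eventually (eventually_ge_atTop 1), eventually_ge_atTop 1] with n h1 h2 h3 hn
      refine (hblock _ ordConnected_Iio n).trans (mul_le_mul_of_nonneg_left ?_ hC.le)
      have hlog := floor_log_div_mul_le hc hn
      have hlog' := log_lt_mul_floor_log_div_add_one hc n
      set l := ⌊Real.log n / c⌋₊
      have hl : (1 : ℝ) ≤ l := by exact_mod_cast h3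
      have hn' : (0 : ℝ) < n := by exact_mod_cast hn
      have hmeas : NullMeasurableSet {x | (l : ℝ) * a ≤ birkhoff T φ l x} μ :=
        (aemeasurable_birkhoff hT hφ l).nullMeasurableSet_preimage measurableSet_Ici
      have hcompl : {x | birkhoff T φ l x ∈ Iio ((l : ℝ) * a)} =
          {x | (l : ℝ) * a ≤ birkhoff T φ l x}ᶜ := by ext x; simp
      have hq : (μ {x | birkhoff T φ l x ∈ Iio ((l : ℝ) * a)}).toReal
          = 1 - (μ {x | (l : ℝ) * a ≤ birkhoff T φ l x}).toReal := by
        rw [hcompl, prob_compl_eq_one_sub₀ hmeas, ENNReal.toReal_sub_of_le prob_le_one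
          ENNReal.one_ne_top, ENNReal.toReal_one]
      set p := (μ {x | (l : ℝ) * a ≤ birkhoff T φ l x}).toReal
      have hqle : (μ {x | birkhoff T φ l x ∈ Iio ((l : ℝ) * a)}).toReal ≤ Real.exp (-p) := by
        rw [hq]; linarith [Real.add_one_le_exp (-p)]
      calc _ ≤ Real.exp (-p) ^ ((n : ℝ) / (l : ℝ) ^ τ) :=
            Real.rpow_le_rpow ENNReal.toReal_nonneg hqle (by positivity)
        _ = Real.exp (-(p * n / (l : ℝ) ^ τ)) := by rw [← Real.exp_mul]; ring_nf
        _ ≤ Real.exp (-(2 * Real.log n)) := by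
            refine Real.exp_le_exp.2 (neg_le_neg ?_)
            calc 2 * Real.log n ≤ 4 * c * l := by nlinarith
              _ ≤ Real.exp ((c - b') * l) / (l : ℝ) ^ τ := h2
              _ ≤ p * n / (l : ℝ) ^ τ := by
                gcongr
                calc Real.exp ((c - b') * l)
                    = Real.exp (-(b' * l)) * Real.exp (c * l) := by
                      rw [← Real.exp_add]; ring_nf
                  _ ≤ p * n := by
                      gcongr
                      rwa [← Real.le_log_iff_exp_le hn']
        _ = 1 / (n : ℝ) ^ 2 := by
            rw [Real.exp_neg, two_mul, Real.exp_add, Real.exp_log hn']; ring)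
  filter_upwards [key] with x hx
  filter_upwards [hx] with n hn
  simpa using hn

/-- If the tails at level `a` decay at a rate `b > c`, then almost surely all windows of length
`⌊log n / c⌋` have average less than `a` for infinitely many `n`. -/
theorem ae_frequently_forall_birkhoff_lt {X : Type*} [MeasurableSpace X] {μ : Measure X}
    [IsProbabilityMeasure μ] {T : X → X} (hT : MeasurePreserving T μ μ) {φ : X → ℝ}
    (hφ : AEMeasurable φ μ) {a b c : ℝ} (hc : 0 < c) (hcb : c < b)
    (hLDP : Tendsto (fun n : ℕ =>
        Real.log ((μ {x | (n : ℝ) * a ≤ birkhoff T φ n x}).toReal) / (n : ℝ))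
      atTop (nhds (-b))) :
    ∀ᵐ x ∂μ, ∃ᶠ n : ℕ in atTop, ∀ m ∈ Finset.range (n - ⌊Real.log n / c⌋₊ + 1),
      birkhoff T φ ⌊Real.log n / c⌋₊ (T^[m] x) < (⌊Real.log n / c⌋₊ : ℝ) * a := by
  obtain ⟨b', hcb', hb'b⟩ := exists_between hcb
  have hpow : Tendsto (fun k : ℕ => 2 ^ k) atTop (atTop : Filter ℕ) :=
    tendsto_pow_atTop_atTop_of_one_lt one_lt_two
  have hfl := tendsto_floor_log_div_atTop hc
  have hlog2 : 0 < Real.log 2 := Real.log_pos one_lt_two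
  have hδ : (1 - b' / c) * Real.log 2 < 0 :=
    mul_neg_of_neg_of_pos (sub_neg.2 ((one_lt_div hc).2 hcb')) hlog2
  have hsum : Summable fun k : ℕ =>
      2 * Real.exp b' * Real.exp (k * ((1 - b' / c) * Real.log 2)) :=
    (Real.summable_exp_nat_mul_iff.2 hδ).mul_left _
  have key := ae_eventually_notMem_of_toReal_le (μ := μ)
    (s := fun k : ℕ => ⋃ m ∈ Finset.range (2 ^ k - ⌊Real.log (2 ^ k : ℕ) / c⌋₊ + 1),
      {x | (⌊Real.log (2 ^ k : ℕ) / c⌋₊ : ℝ) * a ≤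
        birkhoff T φ ⌊Real.log (2 ^ k : ℕ) / c⌋₊ (T^[m] x)})
    hsum (by
      filter_upwards [(hfl.comp hpow).eventually (eventually_le_exp_neg_mul
          (fun _ => ENNReal.toReal_nonneg) hb'b hLDP)] with k h1
      have hlog' := log_lt_mul_floor_log_div_add_one hc (2 ^ k)
      simp only [Function.comp] at h1
      have hn1 : 1 ≤ 2 ^ k := Nat.one_le_two_pow
      have hlogn : Real.log ((2 ^ k : ℕ) : ℝ) = k * Real.log 2 := by
        push_cast; rw [Real.log_pow]
      generalize 2 ^ k = n at *
      set l := ⌊Real.log n / c⌋₊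
      have hn' : (0 : ℝ) < n := by exact_mod_cast hn1
      have hmeas : NullMeasurableSet {x | (l : ℝ) * a ≤ birkhoff T φ l x} μ :=
        (aemeasurable_birkhoff hT hφ l).nullMeasurableSet_preimage measurableSet_Ici
      have hunion : (μ (⋃ m ∈ Finset.range (n - l + 1),
          {x | (l : ℝ) * a ≤ birkhoff T φ l (T^[m] x)})).toReal
          ≤ ((n - l + 1 : ℕ) : ℝ) * (μ {x | (l : ℝ) * a ≤ birkhoff T φ l x}).toReal := by
        refine (measureReal_biUnion_finset_le _ _).trans_eq ?_
        have hm (m : ℕ) : μ.real {x | (l : ℝ) * a ≤ birkhoff T φ l (T^[m] x)} =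
            (μ {x | (l : ℝ) * a ≤ birkhoff T φ l x}).toReal :=
          congrArg ENNReal.toReal ((hT.iterate m).measure_preimage hmeas)
        simp [hm]
      have hcount : ((n - l + 1 : ℕ) : ℝ) ≤ 2 * n := by
        exact_mod_cast (by omega : n - l + 1 ≤ 2 * n)
      have hlc : Real.log n / c - 1 ≤ l := by
        rw [sub_le_iff_le_add, div_le_iff₀ hc]; linarith
      calc _ ≤ _ := hunion
        _ ≤ 2 * n * Real.exp (-(b' * l)) := by gcongr
        _ ≤ 2 * n * Real.exp (-(b' * (Real.log n / c - 1))) := by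
            have : 0 < b' := hc.trans hcb'
            gcongr
        _ = 2 * Real.exp b' * Real.exp (k * ((1 - b' / c) * Real.log 2)) := by
            nth_rewrite 1 [← Real.exp_log hn']
            rw [mul_assoc, mul_assoc, ← Real.exp_add, ← Real.exp_add, hlogn]
            ring_nf)
  filter_upwards [key] with x hx
  refine hpow.frequently (Eventually.frequently ?_)
  filter_upwards [hx] with k hk
  simpa using hk

/-- Lower Erdős–Rényi law: assume `φ` satisfies a large deviation principle with rate
function `I` on the open neighborhood `U` of `0`, `α > 0` lies in `U`, and with
`ℓ_n = ⌊(log n)/I(α)⌋` assume furthermore that for some `C > 0` and integer `τ ≥ 0`,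
for every interval `A` one has
`μ(⋂_{m=0}^{n−ℓ_n} {S_{ℓ_n}(φ)∘T^m ∈ A}) ≤ C·[μ(S_{ℓ_n}(φ) ∈ A)]^{n/ℓ_n^τ}`. Then for
a.e. `x`, `liminf_n max_{0 ≤ j ≤ n−ℓ_n} (1/ℓ_n) S_{ℓ_n}(φ)(T^j x) ≥ α`. -/
theorem lower_erdos_renyi_law
    {X : Type*} [MeasurableSpace X] (μ : Measure X) [IsProbabilityMeasure μ]
    (T : X → X) (hT : MeasurePreserving T μ μ)
    (φ : X → ℝ) (hφint : Integrable φ μ) (hφmean : ∫ x, φ x ∂μ = 0)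
    (U : Set ℝ) (hUopen : IsOpen U) (hU0 : (0 : ℝ) ∈ U)
    (I : ℝ → ℝ) (hIconv : StrictConvexOn ℝ U I)
    (hInonneg : ∀ a ∈ U, 0 ≤ I a) (hIzero : ∀ a ∈ U, (I a = 0 ↔ a = 0))
    (hLDPpos : ∀ a ∈ U, 0 < a →
      Tendsto (fun n : ℕ =>
          Real.log ((μ {x | (n : ℝ) * a ≤ birkhoff T φ n x}).toReal) / (n : ℝ))
        atTop (nhds (-(I a))))
    (hLDPneg : ∀ a ∈ U, a < 0 →
      Tendsto (fun n : ℕ =>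
          Real.log ((μ {x | birkhoff T φ n x ≤ (n : ℝ) * a}).toReal) / (n : ℝ))
        atTop (nhds (-(I a))))
    (α : ℝ) (hα : 0 < α) (hαU : α ∈ U)
    (C : ℝ) (hC : 0 < C) (τ : ℕ)
    (hblock : ∀ A : Set ℝ, A.OrdConnected → ∀ n : ℕ,
      (μ (⋂ m ∈ Finset.range (n - ⌊Real.log n / I α⌋₊ + 1),
          {x | birkhoff T φ ⌊Real.log n / I α⌋₊ (T^[m] x) ∈ A})).toReal ≤
        C * ((μ {x | birkhoff T φ ⌊Real.log n / I α⌋₊ x ∈ A}).toReal) ^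
          ((n : ℝ) / (⌊Real.log n / I α⌋₊ : ℝ) ^ τ)) :
    ∀ᵐ x ∂μ,
      α ≤ liminf (fun n : ℕ =>
          (Finset.range (n - ⌊Real.log n / I α⌋₊ + 1)).sup'
            (Finset.nonempty_range_iff.mpr (Nat.succ_ne_zero _))
            (fun j =>
              birkhoff T φ ⌊Real.log n / I α⌋₊ (T^[j] x) / (⌊Real.log n / I α⌋₊ : ℝ)))
        atTop := by
  have hI0 : I 0 = 0 := (hIzero 0 hU0).2 rfl
  have hφm : AEMeasurable φ μ := hφint.aemeasurable
  have hc : 0 < I α :=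
    (hInonneg α hαU).lt_of_ne fun h => hα.ne' ((hIzero α hαU).1 h.symm)
  obtain ⟨u, -, hu, hulim⟩ := exists_seq_strictMono_tendsto' hα
  have huU : ∀ k, u k ∈ U := fun k =>
    hIconv.1.ordConnected.out hU0 hαU ⟨(hu k).1.le, (hu k).2.le⟩
  obtain ⟨β, hαβ, hβU⟩ : ∃ β, α < β ∧ β ∈ U := by
    obtain ⟨ε, hε, hball⟩ := Metric.isOpen_iff.1 hUopen α hαU
    refine ⟨α + ε / 2, by linarith, hball ?_⟩
    rw [Metric.mem_ball, Real.dist_eq, add_sub_cancel_left, abs_of_pos (half_pos hε)]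
    exact half_lt_self hε
  have hlower : ∀ᵐ x ∂μ, ∀ k, ∀ᶠ n : ℕ in atTop,
      ∃ m ∈ Finset.range (n - ⌊Real.log n / I α⌋₊ + 1), (⌊Real.log n / I α⌋₊ : ℝ) * u k ≤
        birkhoff T φ ⌊Real.log n / I α⌋₊ (T^[m] x) :=
    ae_all_iff.2 fun k => ae_eventually_exists_le_birkhoff hT hφm
      ((hInonneg _ (huU k)).lt_of_ne fun h => (hu k).1.ne' ((hIzero _ (huU k)).1 h.symm))
      (hIconv.lt_of_pos_of_lt hU0 hI0 hInonneg (hu k).1 (hu k).2 hαU)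
      (hLDPpos _ (huU k) (hu k).1) hC τ hblock
  have hupper := ae_frequently_forall_birkhoff_lt hT hφm hc
    (hIconv.lt_of_pos_of_lt hU0 hI0 hInonneg hα hαβ hβU) (hLDPpos β hβU (hα.trans hαβ))
  have hpos : ∀ᶠ n : ℕ in atTop, (0 : ℝ) < (⌊Real.log n / I α⌋₊ : ℝ) := by
    filter_upwards [(tendsto_floor_log_div_atTop hc).eventually (eventually_gt_atTop 0)]
      with n hn
    exact_mod_cast hn
  filter_upwards [hlower, hupper] with x hlow hupp
  refine le_of_tendsto' hulim fun k => le_liminf_of_le ?_ ?_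
  · refine IsCoboundedUnder.of_frequently_le (a := β) ?_
    refine (hupp.and_eventually hpos).mono fun n ⟨hn, hn0⟩ => ?_
    refine Finset.sup'_le _ _ fun m hm => ?_
    rw [div_le_iff₀ hn0, mul_comm]
    exact (hn m hm).le
  · filter_upwards [hlow k, hpos] with n ⟨m, hm, hle⟩ hn0
    refine Finset.le_sup'_of_le _ hm ?_
    rwa [le_div_iff₀ hn0, mul_comm]
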